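/- Fix an integer b ≥ 1 and set ρ_b = (1 − b^b e^{−b}/b!)^{−1}. Define the sequence f by f(1) = 1 and f(j+1) = (1/b)(j·f(j) − ρ_b·min(j,b)) + 1 for j ≥ 1. Then for every integer t ≥ b one has f(t) ≥ (ρ_b − 1)·b/t > 0, and consequently the series Σ_{t=1}^{∞} f(t) diverges to +∞. -/

import Mathlib

/-- `ρ_b = (1 − b^b e^{−b}/b!)⁻¹`. -/
noncomputable def rhoB (b : ℕ) : ℝ :=
  (1 - (b : ℝ) ^ b * Real.exp (-(b : ℝ)) / (Nat.factorial b : ℝ))⁻¹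

/-- The asymptotically optimal utility rule for the bent welfare rule
`w(j) = min(j,b)` : `f_b(1) = 1`, `f_b(j+1) = (1/b)(j·f_b(j) − ρ_b·min(j,b)) + 1`. -/
noncomputable def fB (b : ℕ) : ℕ → ℝ
  | 0 => 0
  | 1 => 1
  | (j + 2) => (1 / (b : ℝ)) * ((j + 1 : ℝ) * fB b (j + 1) -
      rhoB b * ((min (j + 1) b : ℕ) : ℝ)) + 1

/-- The scaled sequence `f_b(n+1) b^n / n!` has explicit increments. -/
lemma fB_scaled_succ (b : ℕ) (hb : 1 ≤ b) (n : ℕ) :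
    fB b (n + 2) * b ^ (n + 1) / (n + 1).factorial =
      fB b (n + 1) * b ^ n / n.factorial + (b : ℝ) ^ (n + 1) / (n + 1).factorial -
        rhoB b * ((min (n + 1) b : ℕ) : ℝ) * b ^ n / (n + 1).factorial := by
  have hb0 : (b : ℝ) ≠ 0 := by positivity
  have hn : (n.factorial : ℝ) ≠ 0 := by positivity
  have hn1 : (n : ℝ) + 1 ≠ 0 := by positivity
  rw [fB, Nat.factorial_succ]
  generalize ((min (n + 1) b : ℕ) : ℝ) = m
  push_cast
  field_simp
  ring

open Finset in
lemma fB_scaled_of_le (b : ℕ) (hb : 1 ≤ b) (n : ℕ) (hn : n ≤ b) :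
    fB b (n + 1) * b ^ n / n.factorial =
      ∑ i ∈ range (n + 1), (b : ℝ) ^ i / i.factorial -
        rhoB b * ∑ i ∈ range n, (b : ℝ) ^ i / i.factorial := by
  induction n with
  | zero => simp [fB]
  | succ n ih =>
    have hf : (n.factorial : ℝ) ≠ 0 := by positivity
    have hn1 : (n : ℝ) + 1 ≠ 0 := by positivity
    have hmin : rhoB b * ((min (n + 1) b : ℕ) : ℝ) * b ^ n / (n + 1).factorial =
        rhoB b * ((b : ℝ) ^ n / n.factorial) := by
      rw [min_eq_left hn, Nat.factorial_succ]
      push_cast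
      field_simp
    rw [fB_scaled_succ b hb, ih (by omega), hmin, sum_range_succ _ (n + 1),
      sum_range_succ _ n]
    ring

lemma pow_div_factorial_lt_exp (b : ℕ) (hb : 1 ≤ b) :
    (b : ℝ) ^ b / b.factorial < Real.exp b := by
  have h := Real.sum_le_exp_of_nonneg (Nat.cast_nonneg b : (0 : ℝ) ≤ b) (b + 1)
  have hpos : 0 < ∑ i ∈ Finset.range b, (b : ℝ) ^ i / i.factorial :=
    Finset.sum_pos (fun i _ => by positivity) ⟨0, Finset.mem_range.2 hb⟩
  rw [Finset.sum_range_succ] at h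
  linarith

lemma one_lt_rhoB (b : ℕ) (hb : 1 ≤ b) : 1 < rhoB b := by
  have h := pow_div_factorial_lt_exp b hb
  have hb0 : (0 : ℝ) < b := by exact_mod_cast hb
  refine (one_lt_inv₀ ?_).2 ?_
  · rw [mul_div_right_comm, Real.exp_neg, ← div_eq_mul_inv, sub_pos,
      div_lt_one (Real.exp_pos _)]
    exact h
  · have : 0 < (b : ℝ) ^ b * Real.exp (-(b : ℝ)) / b.factorial := by positivity
    linarith

lemma rhoB_mul_pow_div_factorial (b : ℕ) (hb : 1 ≤ b) :
    rhoB b * ((b : ℝ) ^ b / b.factorial) = (rhoB b - 1) * Real.exp b := by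
  have hne : rhoB b ≠ 0 := (zero_lt_one.trans (one_lt_rhoB b hb)).ne'
  have h : rhoB b * (1 - (b : ℝ) ^ b * Real.exp (-(b : ℝ)) / b.factorial) = 1 :=
    inv_mul_cancel₀ fun h0 => hne (by rw [rhoB, h0, inv_zero])
  have hexp : Real.exp (-(b : ℝ)) * Real.exp b = 1 := by
    rw [← Real.exp_add, neg_add_cancel, Real.exp_zero]
  linear_combination (-Real.exp b) * h - rhoB b * ((b : ℝ) ^ b / b.factorial) * hexp

open Finset in
/-- From index `b` on, the scaled sequence is `ρ_b - 1` times a tail of the series of `e^b`. -/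
lemma fB_scaled_of_ge (b : ℕ) (hb : 1 ≤ b) (n : ℕ) (hn : b ≤ n + 1) :
    fB b (n + 1) * b ^ n / n.factorial =
      (rhoB b - 1) * (Real.exp b - ∑ i ∈ range (n + 1), (b : ℝ) ^ i / i.factorial) := by
  obtain ⟨m, rfl⟩ : ∃ m, b = m + 1 := ⟨b - 1, by omega⟩
  have hmn : m ≤ n := by omega
  clear hn
  induction n, hmn using Nat.le_induction with
  | base =>
    have hf : (m.factorial : ℝ) ≠ 0 := by positivity
    have hm1 : (m : ℝ) + 1 ≠ 0 := by positivity
    have hrho := rhoB_mul_pow_div_factorial (m + 1) hb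
    have hterm : ((m + 1 : ℕ) : ℝ) ^ (m + 1) / (m + 1).factorial =
        ((m + 1 : ℕ) : ℝ) ^ m / m.factorial := by
      rw [Nat.factorial_succ]
      push_cast
      field_simp
      ring
    rw [hterm] at hrho
    rw [fB_scaled_of_le _ hb m (by omega), sum_range_succ]
    linear_combination hrho
  | succ n hmn ih =>
    rw [fB_scaled_succ _ hb, ih, min_eq_right (by omega), sum_range_succ _ (n + 1)]
    ring

lemma le_fB (b : ℕ) (hb : 1 ≤ b) (t : ℕ) (ht : b ≤ t) :
    (rhoB b - 1) * b / t ≤ fB b t := by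
  obtain ⟨n, rfl⟩ : ∃ n, t = n + 1 := ⟨t - 1, by omega⟩
  have hb0 : (0 : ℝ) < b := by exact_mod_cast hb
  have htail := Real.sum_le_exp_of_nonneg hb0.le (n + 2)
  rw [Finset.sum_range_succ] at htail
  have hscale : (0 : ℝ) < b ^ n / n.factorial := by positivity
  refine le_of_mul_le_mul_right ?_ hscale
  calc (rhoB b - 1) * b / (n + 1 : ℕ) * (b ^ n / n.factorial)
      = (rhoB b - 1) * ((b : ℝ) ^ (n + 1) / (n + 1).factorial) := by
        rw [Nat.factorial_succ]
        push_cast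
        field_simp
        ring
    _ ≤ (rhoB b - 1) *
          (Real.exp b - ∑ i ∈ Finset.range (n + 1), (b : ℝ) ^ i / i.factorial) :=
        mul_le_mul_of_nonneg_left (by linarith) (by linarith [one_lt_rhoB b hb])
    _ = fB b (n + 1) * (b ^ n / n.factorial) := by
        rw [← fB_scaled_of_ge b hb n ht, mul_div_assoc]

/-- A real sequence eventually bounded below by `K / t` with `K > 0` has partial sums
tending to infinity. -/
lemma tendsto_sum_Icc_atTop_of_div_le {f : ℕ → ℝ} {K : ℝ} (hK : 0 < K) (b : ℕ)
    (hf : ∀ t, b ≤ t → K / t ≤ f t) :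
    Filter.Tendsto (fun N : ℕ => ∑ t ∈ Finset.Icc 1 N, f t) Filter.atTop Filter.atTop := by
  have hharm : Filter.Tendsto (fun N : ℕ => ∑ t ∈ Finset.Icc 1 N, 1 / (t : ℝ))
      Filter.atTop Filter.atTop := by
    convert Real.tendsto_sum_range_one_div_nat_succ_atTop using 2 with N
    rw [← Finset.Ico_add_one_right_eq_Icc, Finset.sum_Ico_eq_sum_range]
    refine Finset.sum_congr (by simp) fun i _ => ?_
    push_cast
    rw [add_comm]
  refine Filter.tendsto_atTop_mono' _ ?_ (Filter.tendsto_atTop_add_const_left _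
    (∑ t ∈ Finset.Icc 1 b, (f t - K * (1 / t))) (hharm.const_mul_atTop hK))
  filter_upwards [Filter.eventually_ge_atTop b] with N hN
  have hle : ∑ t ∈ Finset.Icc 1 b, (f t - K * (1 / t)) ≤
      ∑ t ∈ Finset.Icc 1 N, (f t - K * (1 / t)) := by
    refine Finset.sum_le_sum_of_subset_of_nonneg (Finset.Icc_subset_Icc_right hN)
      fun t ht hnot => ?_
    have := hf t (by simp only [Finset.mem_Icc] at ht hnot; omega)
    rw [mul_one_div]
    linarith
  rw [Finset.sum_sub_distrib (s := Finset.Icc 1 N), ← Finset.mul_sum] at hle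
  linarith

/-- For every `t ≥ b`, `f_b(t) ≥ (ρ_b − 1)·b/t > 0`, and
consequently the series `Σ_{t=1}^{∞} f_b(t)` diverges to `+∞`. -/
theorem stmt11 (b : ℕ) (hb : 1 ≤ b) :
    (∀ t : ℕ, b ≤ t → (rhoB b - 1) * b / t ≤ fB b t ∧ 0 < fB b t) ∧
    Filter.Tendsto (fun N : ℕ => ∑ t ∈ Finset.Icc 1 N, fB b t)
      Filter.atTop Filter.atTop := by
  have hb0 : (0 : ℝ) < b := by exact_mod_cast hb
  have hK : 0 < (rhoB b - 1) * b := mul_pos (sub_pos.2 (one_lt_rhoB b hb)) hb0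
  refine ⟨fun t ht => ⟨le_fB b hb t ht, lt_of_lt_of_le ?_ (le_fB b hb t ht)⟩,
    tendsto_sum_Icc_atTop_of_div_le hK b (le_fB b hb)⟩
  exact div_pos hK (hb0.trans_le (by exact_mod_cast ht))
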